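/- Let d ≥ 2 and let V : ℝ^d → ℝ be lower semicontinuous satisfying the growth condition V(x) ≥ a|x|^q − R for some a > 0, R ∈ ℝ, q > 1, and let p ∈ (1, q). Then the electrostatic energy E has a unique minimizer μ_* over P(ℝ^d), this minimizer has compact support, and the infima of E over P(ℝ^d), over P_p(ℝ^d), and over the set of compactly supported probability measures all coincide and equal E(μ_*) > −∞. -/

import Mathlib

open MeasureTheory Filter Metric
open scoped ENNReal NNReal RealInnerProductSpace BigOperators Topology ProbabilityTheory Classical

noncomputable section

/-- `ℝ^d` as a Euclidean space. -/
abbrev Euc (d : ℕ) : Type := EuclideanSpace ℝ (Fin d)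

/-- The Coulomb kernel `g`, valued in `ℝ ∪ {+∞}` (`= ⊤` at the origin). -/
noncomputable def coulombK (d : ℕ) (x : Euc d) : EReal :=
  if x = 0 then ⊤
  else if d = 2 then ((Real.log (1 / ‖x‖) : ℝ) : EReal)
  else ((1 / (((d : ℝ) - 2) * ‖x‖ ^ ((d : ℕ) - 2)) : ℝ) : EReal)

/-- Positive part of an extended real, as an extended nonnegative real. -/
noncomputable def posP (x : EReal) : ℝ≥0∞ := if x = ⊤ then ⊤ else ENNReal.ofReal x.toReal

/-- The electrostatic energy `E(μ) = ∬ (g(x-y) + (V x + V y)/2) dμ dμ`, valued in `EReal`,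
defined as the difference of the integrals of the positive and negative parts of the
integrand. -/
noncomputable def energy (d : ℕ) (V : Euc d → ℝ) (μ : Measure (Euc d)) : EReal :=
  ((∫⁻ q : Euc d × Euc d,
      posP (coulombK d (q.1 - q.2) + (((V q.1 + V q.2) / 2 : ℝ) : EReal)) ∂(μ.prod μ) : ℝ≥0∞) : EReal)
  - ((∫⁻ q : Euc d × Euc d,
      posP (-(coulombK d (q.1 - q.2) + (((V q.1 + V q.2) / 2 : ℝ) : EReal))) ∂(μ.prod μ) : ℝ≥0∞) : EReal)

/-- Finiteness of the `p`-th moment of a measure on `ℝ^d`. -/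
def FiniteMoment (d : ℕ) (p : ℝ) (μ : Measure (Euc d)) : Prop :=
  ∫⁻ x, ENNReal.ofReal (‖x‖ ^ p) ∂μ ≠ ⊤

/-- Couplings of two measures. -/
def Couplings (d : ℕ) (μ ν : Measure (Euc d)) : Set (Measure (Euc d × Euc d)) :=
  {π | π.map Prod.fst = μ ∧ π.map Prod.snd = ν}

/-- The `p`-Wasserstein distance (valued in `ℝ≥0∞`). -/
noncomputable def wassDist (d : ℕ) (p : ℝ) (μ ν : Measure (Euc d)) : ℝ≥0∞ :=
  (⨅ π ∈ Couplings d μ ν, ∫⁻ q : Euc d × Euc d, ENNReal.ofReal (‖q.1 - q.2‖ ^ p) ∂π) ^ (1 / p)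

/-- Real-valued Coulomb kernel (junk value at the origin; only used in densities with
respect to Lebesgue measure, for which the diagonal is negligible). -/
noncomputable def coulombKR (d : ℕ) (x : Euc d) : ℝ :=
  if d = 2 then Real.log (1 / ‖x‖) else 1 / (((d : ℝ) - 2) * ‖x‖ ^ ((d : ℕ) - 2))

/-- The Coulomb gas Hamiltonian `H_n`. -/
noncomputable def hamiltonian (d n : ℕ) (V : Euc d → ℝ) (x : Fin n → Euc d) : ℝ :=
  (1 / (n : ℝ)) * ∑ i, V (x i)
    + (1 / (n : ℝ) ^ 2) *
        ∑ q ∈ Finset.univ.filter (fun q : Fin n × Fin n => q.1 ≠ q.2), coulombKR d (x q.1 - x q.2)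

/-- The Gibbs measure `P_n` with density proportional to `exp(-β H_n)`. -/
noncomputable def gibbs (d n : ℕ) (β : ℝ) (V : Euc d → ℝ) : Measure (Fin n → Euc d) :=
  ((∫⁻ x, ENNReal.ofReal (Real.exp (-β * hamiltonian d n V x)) ∂(Measure.pi fun _ => volume))⁻¹) •
    (Measure.pi fun _ => (volume : Measure (Euc d))).withDensity
      (fun x => ENNReal.ofReal (Real.exp (-β * hamiltonian d n V x)))

/-- Empirical measure of a configuration. -/
noncomputable def empMeas (d n : ℕ) (x : Fin n → Euc d) : Measure (Euc d) :=
  ((n : ℝ≥0∞))⁻¹ • ∑ i, Measure.dirac (x i)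

/-- Uniform probability measure on the closed ball of radius 1 centered at `c`. -/
noncomputable def uniformBall (d : ℕ) (c : Euc d) : Measure (Euc d) :=
  (volume (Metric.closedBall c 1))⁻¹ • volume.restrict (Metric.closedBall c 1)

/-- Support of a measure. -/
def measSupport (d : ℕ) (μ : Measure (Euc d)) : Set (Euc d) :=
  {x | ∀ U : Set (Euc d), IsOpen U → x ∈ U → μ U ≠ 0}

/-- The Coulomb interaction energy `J(μ) = ∬ g(x-y) dμ dμ` (the energy with `V = 0`). -/
noncomputable def interactionJ (d : ℕ) (μ : Measure (Euc d)) : EReal :=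
  energy d (fun _ => 0) μ

/-- A set has null capacity if it contains no compact set carrying a probability measure
of finite Coulomb interaction energy. -/
def NullCapacity (d : ℕ) (A : Set (Euc d)) : Prop :=
  ∀ K : Set (Euc d), K ⊆ A → IsCompact K →
    ∀ μ : Measure (Euc d), IsProbabilityMeasure μ → μ Kᶜ = 0 → interactionJ d μ = ⊤

/-- A property holds quasi-everywhere if it holds outside a Borel set of null capacity. -/
def QuasiEverywhere (d : ℕ) (P : Euc d → Prop) : Prop :=
  ∃ N : Set (Euc d), MeasurableSet N ∧ NullCapacity d N ∧ ∀ x ∉ N, P x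

/-- The Coulomb potential `(g * μ)(x) = ∫ g(x - y) μ(dy)`, valued in `EReal`. -/
noncomputable def coulombPot (d : ℕ) (μ : Measure (Euc d)) (x : Euc d) : EReal :=
  ((∫⁻ y, posP (coulombK d (x - y)) ∂μ : ℝ≥0∞) : EReal)
  - ((∫⁻ y, posP (-(coulombK d (x - y))) ∂μ : ℝ≥0∞) : EReal)

/-- The set `P_p(ℝ^d)` of probability measures with finite `p`-th moment. -/
def Ppd (d : ℕ) (p : ℝ) : Set (Measure (Euc d)) :=
  {μ | IsProbabilityMeasure μ ∧ FiniteMoment d p μ}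

/-- `B` is closed in the `p`-Wasserstein topology (within `P_p(ℝ^d)`). -/
def WClosedIn (d : ℕ) (p : ℝ) (B : Set (Measure (Euc d))) : Prop :=
  ∀ μ ∈ Ppd d p, (∀ ε : ℝ, 0 < ε → ∃ ν ∈ B, wassDist d p μ ν < ENNReal.ofReal ε) → μ ∈ B

/-- Interior of `B` in the `p`-Wasserstein topology (within `P_p(ℝ^d)`). -/
def wInterior (d : ℕ) (p : ℝ) (B : Set (Measure (Euc d))) : Set (Measure (Euc d)) :=
  {μ | μ ∈ B ∧ ∃ ε : ℝ, 0 < ε ∧ ∀ ν ∈ Ppd d p, wassDist d p μ ν < ENNReal.ofReal ε → ν ∈ B}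

/-- The growth condition `V(x) ≥ a |x|^q - R`. -/
def GrowthCond (d : ℕ) (V : Euc d → ℝ) (a q R : ℝ) : Prop :=
  ∀ x : Euc d, a * ‖x‖ ^ q - R ≤ V x



lemma lsc_lintegral {Z : Type*} [TopologicalSpace Z] [MeasurableSpace Z] [BorelSpace Z]
    [TopologicalSpace.PseudoMetrizableSpace Z] [SecondCountableTopology Z]
    (H : Z → ℝ≥0∞) (hH : LowerSemicontinuous H) :
    LowerSemicontinuous (fun μ : ProbabilityMeasure Z => ∫⁻ z, H z ∂(μ : Measure Z)) := by
  have key : ∀ n : ℕ, LowerSemicontinuous (fun μ : ProbabilityMeasure Z =>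
      ∫⁻ z, ENNReal.ofReal ((min (H z) n).toReal) ∂(μ : Measure Z)) := by
    intro n
    rw [lowerSemicontinuous_iff_le_liminf]
    intro μ
    have hm : Measurable (fun z => (min (H z) n).toReal) :=
      (hH.measurable.min measurable_const).ennreal_toReal
    have hopen : ∀ t ∈ Set.Ioi (0:ℝ), IsOpen {z | t < (min (H z) (n : ℝ≥0∞)).toReal} := by
      intro t ht
      have : {z | t < (min (H z) (n : ℝ≥0∞)).toReal} =
          {z | ENNReal.ofReal t < H z} ∩ {z | ENNReal.ofReal t < n} := by
        ext z
        have hne : min (H z) (n : ℝ≥0∞) ≠ ⊤ := ne_top_of_le_ne_top (by simp) (min_le_right _ _)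
        simp only [Set.mem_ofPred_eq, Set.mem_inter_iff]
        rw [← lt_min_iff, ENNReal.ofReal_lt_iff_lt_toReal (le_of_lt ht) hne]
      rw [this]
      exact (hH.isOpen_preimage _).inter isOpen_const
    simp_rw [lintegral_eq_lintegral_meas_lt _ (Eventually.of_forall (fun _ => ENNReal.toReal_nonneg))
      hm.aemeasurable]
    calc ∫⁻ (t : ℝ) in Set.Ioi 0, (μ : Measure Z) {a | t < (min (H a) n).toReal}
        ≤ ∫⁻ (t : ℝ) in Set.Ioi 0, (𝓝 μ).liminf
            (fun i : ProbabilityMeasure Z ↦ (i : Measure Z) {a | t < (min (H a) n).toReal}) := by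
          apply setLIntegral_mono_ae' measurableSet_Ioi
          refine Eventually.of_forall fun t ht => ?_
          exact ProbabilityMeasure.le_liminf_measure_open_of_tendsto tendsto_id (hopen t ht)
      _ ≤ _ := lintegral_liminf_le (fun n ↦ Antitone.measurable (fun s t hst ↦
            measure_mono (fun ω hω ↦ lt_of_le_of_lt hst hω)))
  have heq : (fun μ : ProbabilityMeasure Z => ∫⁻ z, H z ∂(μ : Measure Z)) =
      fun μ : ProbabilityMeasure Z => ⨆ n : ℕ,
        ∫⁻ z, ENNReal.ofReal ((min (H z) n).toReal) ∂(μ : Measure Z) := by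
    ext μ
    have h1 : ∀ n : ℕ, ∀ z, ENNReal.ofReal ((min (H z) n).toReal) = min (H z) n := fun n z =>
      ENNReal.ofReal_toReal (ne_top_of_le_ne_top (by simp) (min_le_right _ _))
    simp_rw [h1]
    rw [← lintegral_iSup]
    · congr 1
      ext z
      rw [← inf_iSup_eq, ENNReal.iSup_natCast, inf_top_eq]
    · intro n
      exact hH.measurable.min measurable_const
    · intro m n hmn z
      exact min_le_min le_rfl (by exact_mod_cast hmn)
  rw [heq]
  exact lowerSemicontinuous_iSup key

section abstractMin
variable {X : Type*} [TopologicalSpace X] [MeasurableSpace X] [BorelSpace X]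
    [TopologicalSpace.MetrizableSpace X] [SecondCountableTopology X]

/-- coercivity -/
def Coer (H : X × X → ℝ≥0∞) : Prop :=
  ∀ L : ℝ≥0, ∃ K : Set X, IsCompact K ∧ ∀ z : X × X, (z.1 ∉ K ∨ z.2 ∉ K) → (L : ℝ≥0∞) ≤ H z

lemma coer_bound (H : X × X → ℝ≥0∞) (L : ℝ≥0) (K : Set X) (hK : IsCompact K)
    (h : ∀ z : X × X, (z.1 ∉ K ∨ z.2 ∉ K) → (L : ℝ≥0∞) ≤ H z)
    (μ : Measure X) [IsProbabilityMeasure μ] :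
    L * μ Kᶜ ≤ ∫⁻ z, H z ∂(μ.prod μ) := by
  have hm := hK.measurableSet
  calc L * μ Kᶜ = ∫⁻ z in (Kᶜ ×ˢ Set.univ), (L : ℝ≥0∞) ∂(μ.prod μ) := by
        simp
    _ ≤ ∫⁻ z in (Kᶜ ×ˢ Set.univ), H z ∂(μ.prod μ) := by
        apply setLIntegral_mono_ae' (hm.compl.prod MeasurableSet.univ)
        exact Eventually.of_forall fun z hz => h z (Or.inl hz.1)
    _ ≤ _ := setLIntegral_le_lintegral _ _

lemma exists_min (H : X × X → ℝ≥0∞) (hH : LowerSemicontinuous H) (hc : Coer H)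
    (μ0 : Measure X) [IsProbabilityMeasure μ0] (h0 : ∫⁻ z, H z ∂(μ0.prod μ0) ≠ ⊤) :
    ∃ μs : Measure X, IsProbabilityMeasure μs ∧ ∫⁻ z, H z ∂(μs.prod μs) ≠ ⊤ ∧
      ∀ μ : Measure X, IsProbabilityMeasure μ →
        ∫⁻ z, H z ∂(μs.prod μs) ≤ ∫⁻ z, H z ∂(μ.prod μ) := by
  let N : ProbabilityMeasure X → ℝ≥0∞ := fun μ => ∫⁻ z, H z ∂((μ : Measure X).prod μ)
  have hN : LowerSemicontinuous N := by
    have h1 := lsc_lintegral H hH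
    have h2 : Continuous (fun μ : ProbabilityMeasure X => μ.prod μ) :=
      ProbabilityMeasure.continuous_prod.comp (continuous_id.prodMk continuous_id)
    exact fun μ c hc => (h2.tendsto μ).eventually (h1 _ c hc)
  let P0 : ProbabilityMeasure X := ⟨μ0, inferInstance⟩
  let B : ℝ≥0∞ := N P0
  have hB : B ≠ ⊤ := h0
  let S : Set (ProbabilityMeasure X) := {μ | N μ ≤ B}
  have hSc : IsClosed S := hN.isClosed_preimage B
  have hSt : IsTightMeasureSet {((μ : ProbabilityMeasure X) : Measure X) | μ ∈ S} := by
    rw [isTightMeasureSet_iff_exists_isCompact_measure_compl_le]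
    intro ε hε
    by_cases hεt : ε = ⊤
    · exact ⟨∅, isCompact_empty, by simp [hεt]⟩
    obtain ⟨L, hL⟩ : ∃ L : ℝ≥0, B ≤ ε * L ∧ L ≠ 0 := by
      have hq : B / ε ≠ ⊤ := ENNReal.div_ne_top hB hε.ne'
      refine ⟨(B / ε).toNNReal + 1, ?_, by positivity⟩
      rw [ENNReal.coe_add, ENNReal.coe_toNNReal hq, mul_add, ENNReal.mul_div_cancel hε.ne' hεt]
      exact le_self_add
    obtain ⟨K, hK, hKH⟩ := hc L
    refine ⟨K, hK, ?_⟩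
    rintro _ ⟨μ, hμ, rfl⟩
    have h1 := (coer_bound H L K hK hKH (μ : Measure X)).trans (show _ ≤ B from hμ)
    have h2 := h1.trans hL.1
    rw [mul_comm] at h2
    exact (ENNReal.mul_le_mul_iff_left (by simpa using hL.2) (by simp)).1 h2
  have hScomp : IsCompact S := by
    have := isCompact_closure_of_isTightMeasureSet hSt
    rwa [hSc.closure_eq] at this
  obtain ⟨m, hmS, hmin⟩ := (hN.lowerSemicontinuousOn S).exists_isMinOn ⟨P0, le_refl B⟩ hScomp
  refine ⟨m, inferInstance, ne_top_of_le_ne_top hB hmS, ?_⟩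
  intro μ hμ
  by_cases hμS : (⟨μ, hμ⟩ : ProbabilityMeasure X) ∈ S
  · exact hmin hμS
  · exact le_trans (show N m ≤ B from hmS) (le_of_lt (not_le.1 hμS))

lemma min_compact (H : X × X → ℝ≥0∞) (hH : LowerSemicontinuous H) (hc : Coer H)
    (μs : Measure X) [IsProbabilityMeasure μs] (h0 : ∫⁻ z, H z ∂(μs.prod μs) ≠ ⊤)
    (hmin : ∀ μ : Measure X, IsProbabilityMeasure μ →
        ∫⁻ z, H z ∂(μs.prod μs) ≤ ∫⁻ z, H z ∂(μ.prod μ)) :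
    ∃ K : Set X, IsCompact K ∧ μs Kᶜ = 0 := by
  set E := ∫⁻ z, H z ∂(μs.prod μs) with hE
  obtain ⟨K, hK, hKH⟩ := hc (E.toNNReal + 1)
  have hL : ((E.toNNReal + 1 : ℝ≥0) : ℝ≥0∞) = E + 1 := by
    rw [ENNReal.coe_add, ENNReal.coe_toNNReal h0, ENNReal.coe_one]
  refine ⟨K, hK, ?_⟩
  have hm := hK.measurableSet
  set k := μs K with hk
  have hk1 : k ≤ 1 := prob_le_one
  have hkc : μs Kᶜ = 1 - k := prob_compl_eq_one_sub hm
  -- split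
  have hsplit : E = ∫⁻ z in K ×ˢ K, H z ∂(μs.prod μs) + ∫⁻ z in (K ×ˢ K)ᶜ, H z ∂(μs.prod μs) :=
    (lintegral_add_compl H (hm.prod hm)).symm
  have hA : k * k * E ≤ ∫⁻ z in K ×ˢ K, H z ∂(μs.prod μs) := by
    by_cases hk0 : k = 0
    · simp [hk0]
    have hkt : k ≠ ⊤ := ne_top_of_le_ne_top ENNReal.one_ne_top hk1
    have hp : IsProbabilityMeasure (k⁻¹ • μs.restrict K) := by
      constructor
      simp [← hk, ENNReal.inv_mul_cancel hk0 hkt]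
    have h1 := hmin _ hp
    rw [Measure.prod_smul_left, Measure.prod_smul_right, lintegral_smul_measure,
      lintegral_smul_measure, Measure.prod_restrict] at h1
    calc k * k * E ≤ k * k * (k⁻¹ • k⁻¹ • ∫⁻ z in K ×ˢ K, H z ∂(μs.prod μs)) := by gcongr
      _ = (k * k⁻¹) * (k * k⁻¹) * ∫⁻ z in K ×ˢ K, H z ∂(μs.prod μs) := by
          simp only [smul_eq_mul]; ring
      _ = _ := by rw [ENNReal.mul_inv_cancel hk0 hkt]; simp
  have hBd : (E + 1) * (1 - k * k) ≤ ∫⁻ z in (K ×ˢ K)ᶜ, H z ∂(μs.prod μs) := by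
    calc (E + 1) * (1 - k * k) = ∫⁻ z in (K ×ˢ K)ᶜ, (E + 1) ∂(μs.prod μs) := by
          rw [setLIntegral_const, prob_compl_eq_one_sub (hm.prod hm), Measure.prod_prod]
      _ ≤ _ := by
          apply setLIntegral_mono_ae' (hm.prod hm).compl
          refine Eventually.of_forall fun z hz => ?_
          rw [← hL]
          apply hKH
          by_contra hcon
          push Not at hcon
          exact hz ⟨hcon.1, hcon.2⟩
  have hkk1 : k * k ≤ 1 := mul_le_one' hk1 hk1
  have h3 : E + (1 - k * k) ≤ E + 0 := by
    calc E + (1 - k * k) = k * k * E + (E + 1) * (1 - k * k) := by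
          have : E = (k * k + (1 - k * k)) * E := by
            rw [add_tsub_cancel_of_le hkk1, one_mul]
          nth_rewrite 1 [this]
          ring
      _ ≤ E + 0 := by
          rw [add_zero]
          nth_rewrite 3 [hsplit]
          exact add_le_add hA hBd
  have h4 := (ENNReal.add_le_add_iff_left h0).1 h3
  have h5 : 1 ≤ k * k := tsub_eq_zero_iff_le.1 (le_antisymm h4 bot_le)
  have h6 : 1 ≤ k := h5.trans (by calc k * k ≤ k * 1 := by gcongr
                                  _ = k := mul_one k)
  rw [hkc, tsub_eq_zero_iff_le.2 h6]

end abstractMin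

section posdef
variable {E : Type*} [NormedAddCommGroup E] [InnerProductSpace ℝ E] [FiniteDimensional ℝ E]
  [MeasurableSpace E] [BorelSpace E]

lemma gauss_measure (b : ℝ) (hb : 0 < b) : ∃ (γ : Measure E) (k : ℝ), IsFiniteMeasure γ ∧
    γ.IsOpenPosMeasure ∧ 0 < k ∧
    ∀ z : E, charFun γ z = ((k * Real.exp (-b * ‖z‖ ^ 2) : ℝ) : ℂ) := by
  set β : ℝ := 1 / (4 * b) with hβ
  have hβ0 : 0 < β := by positivity
  have hint : Integrable (fun ξ : E => Real.exp (-β * ‖ξ‖ ^ 2)) := by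
    have h := (GaussianFourier.integrable_cexp_neg_mul_sq_norm_add (b := (β : ℂ)) (V := E)
      (by simpa using hβ0) 0 0).re
    refine h.congr (Eventually.of_forall fun ξ => ?_)
    simp only [zero_mul, add_zero]
    rw [show (-(β : ℂ) * (‖ξ‖ : ℂ) ^ 2) = ((-β * ‖ξ‖ ^ 2 : ℝ) : ℂ) by push_cast; ring,
      ← Complex.ofReal_exp]
    exact Complex.ofReal_re _
  have hmeas : Measurable (fun ξ : E => ENNReal.ofReal (Real.exp (-β * ‖ξ‖ ^ 2))) := by
    fun_prop
  refine ⟨volume.withDensity (fun ξ : E => ENNReal.ofReal (Real.exp (-β * ‖ξ‖ ^ 2))),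
    (Real.pi / β) ^ (Module.finrank ℝ E / 2 : ℝ), ?_, ?_, by positivity, ?_⟩
  · exact isFiniteMeasure_withDensity_ofReal hint.2
  · have : (volume : Measure E) ≪
        volume.withDensity (fun ξ : E => ENNReal.ofReal (Real.exp (-β * ‖ξ‖ ^ 2))) := by
      apply withDensity_absolutelyContinuous' hmeas.aemeasurable
      exact Eventually.of_forall fun ξ => by simp [Real.exp_pos]
    exact this.isOpenPosMeasure
  · intro z
    rw [charFun_apply, integral_withDensity_eq_integral_toReal_smul hmeas (by simp)]
    have h := GaussianFourier.integral_cexp_neg_mul_sq_norm_add (b := (β : ℂ)) (V := E)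
      (by simpa using hβ0) Complex.I z
    have h2 : (((Real.pi / β) ^ (Module.finrank ℝ E / 2 : ℝ) * Real.exp (-b * ‖z‖ ^ 2) : ℝ) : ℂ)
        = (Real.pi / (β : ℂ)) ^ (Module.finrank ℝ E / 2 : ℂ) *
          Complex.exp (Complex.I ^ 2 * ‖z‖ ^ 2 / (4 * β)) := by
      rw [Complex.ofReal_mul, Complex.ofReal_cpow (by positivity), Complex.ofReal_exp]
      push_cast
      congr 2
      rw [hβ, Complex.I_sq]
      push_cast
      field_simp
    rw [h2, ← h]
    apply integral_congr_ae
    refine Eventually.of_forall fun ξ => ?_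
    simp only
    rw [ENNReal.toReal_ofReal (Real.exp_pos _).le, Complex.real_smul, Complex.ofReal_exp,
      ← Complex.exp_add, real_inner_comm]
    congr 1
    push_cast
    ring

lemma charFun_cont (μ : Measure E) [IsFiniteMeasure μ] : Continuous (charFun μ) := by
  have : charFun μ = fun t => ∫ x, Complex.exp (⟪x, t⟫ * Complex.I) ∂μ := by
    ext t; exact charFun_apply t
  rw [this]
  apply continuous_of_dominated (bound := fun _ => 1)
  · intro t
    exact (by fun_prop : Continuous fun x : E => Complex.exp (⟪x, t⟫ * Complex.I)).aestronglyMeasurable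
  · intro t
    exact Eventually.of_forall fun x => by rw [Complex.norm_exp_ofReal_mul_I]
  · exact integrable_const 1
  · exact Eventually.of_forall fun x => by fun_prop

/-- Gaussian interaction -/
def gaussA (b : ℝ) (μ ν : Measure E) : ℝ :=
  ∫ z : E × E, Real.exp (-b * ‖z.1 - z.2‖ ^ 2) ∂(μ.prod ν)

lemma gaussA_eq (b : ℝ) (k : ℝ) (γ : Measure E) [IsFiniteMeasure γ]
    (hγ : ∀ z : E, charFun γ z = ((k * Real.exp (-b * ‖z‖ ^ 2) : ℝ) : ℂ))
    (μ ν : Measure E) [IsProbabilityMeasure μ] [IsProbabilityMeasure ν] :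
    ((k * gaussA b μ ν : ℝ) : ℂ) = ∫ ξ, charFun μ ξ * (starRingEnd ℂ) (charFun ν ξ) ∂γ := by
  have h1 : ((k * gaussA b μ ν : ℝ) : ℂ) = ∫ z : E × E, charFun γ (z.1 - z.2) ∂(μ.prod ν) := by
    simp_rw [hγ]
    rw [gaussA, ← integral_const_mul, integral_complex_ofReal]
  rw [h1]
  simp_rw [charFun_apply (μ := γ)]
  rw [integral_integral_swap]
  · congr 1
    ext ξ
    rw [← charFun_neg, charFun_apply, charFun_apply, ← integral_prod_mul]
    congr 1
    ext z
    rw [← Complex.exp_add]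
    congr 1
    rw [inner_sub_right, inner_neg_right, real_inner_comm, real_inner_comm z.2]
    push_cast
    ring
  · apply Integrable.of_bound (C := 1)
    · exact (by fun_prop : Continuous (Function.uncurry fun (z : E × E) (ξ : E) =>
        Complex.exp (⟪ξ, z.1 - z.2⟫ * Complex.I))).aestronglyMeasurable
    · exact Eventually.of_forall fun x => by
        simp only [Function.uncurry]; rw [Complex.norm_exp_ofReal_mul_I]

lemma gaussA_comm (b : ℝ) (μ ν : Measure E) [IsProbabilityMeasure μ] [IsProbabilityMeasure ν] :
    gaussA b μ ν = gaussA b ν μ := by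
  unfold gaussA
  rw [← Measure.prod_swap, integral_map (by fun_prop)]
  · congr 1; ext z; simp [norm_sub_rev]
  · exact (by fun_prop : Continuous _).aestronglyMeasurable

lemma gaussA_posdef (b : ℝ) (hb : 0 < b)
    (μ ν : Measure E) [IsProbabilityMeasure μ] [IsProbabilityMeasure ν] :
    2 * gaussA b μ ν ≤ gaussA b μ μ + gaussA b ν ν ∧
    (2 * gaussA b μ ν = gaussA b μ μ + gaussA b ν ν → μ = ν) := by
  obtain ⟨γ, k, hγf, hγo, hk, hγ⟩ := gauss_measure (E := E) b hb
  have hi : ∀ (μ ν : Measure E) [IsProbabilityMeasure μ] [IsProbabilityMeasure ν],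
      Integrable (fun ξ => charFun μ ξ * (starRingEnd ℂ) (charFun ν ξ)) γ := by
    intro μ ν _ _
    apply Integrable.of_bound (C := 1)
    · have h1 := charFun_cont μ
      have h2 := charFun_cont ν
      exact (h1.mul (Complex.continuous_conj.comp h2)).aestronglyMeasurable
    · refine Eventually.of_forall fun ξ => ?_
      rw [norm_mul, RCLike.norm_conj]
      exact mul_le_one₀ (norm_charFun_le_one ξ) (norm_nonneg _) (norm_charFun_le_one ξ)
  have key : k * (gaussA b μ μ + gaussA b ν ν - 2 * gaussA b μ ν) =
      ∫ ξ, ‖charFun μ ξ - charFun ν ξ‖ ^ 2 ∂γ := by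
    apply Complex.ofReal_injective
    have : ((k * (gaussA b μ μ + gaussA b ν ν - 2 * gaussA b μ ν) : ℝ) : ℂ) =
        ((k * gaussA b μ μ : ℝ) : ℂ) + ((k * gaussA b ν ν : ℝ) : ℂ) - ((k * gaussA b μ ν : ℝ) : ℂ)
          - ((k * gaussA b ν μ : ℝ) : ℂ) := by
      rw [gaussA_comm b ν μ]; push_cast; ring
    have i1 : Integrable (fun ξ => charFun μ ξ * (starRingEnd ℂ) (charFun μ ξ) +
        charFun ν ξ * (starRingEnd ℂ) (charFun ν ξ)) γ := (hi μ μ).add (hi ν ν)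
    have i2 : Integrable (fun ξ => charFun μ ξ * (starRingEnd ℂ) (charFun μ ξ) +
        charFun ν ξ * (starRingEnd ℂ) (charFun ν ξ) -
        charFun μ ξ * (starRingEnd ℂ) (charFun ν ξ)) γ := i1.sub (hi μ ν)
    rw [this, gaussA_eq b k γ hγ, gaussA_eq b k γ hγ, gaussA_eq b k γ hγ, gaussA_eq b k γ hγ,
      ← integral_add (hi _ _) (hi _ _), ← integral_sub i1 (hi _ _),
      ← integral_sub i2 (hi _ _), ← integral_complex_ofReal]
    congr 1
    ext ξ
    rw [Complex.ofReal_pow, ← Complex.mul_conj']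
    simp only [map_sub]
    ring
  constructor
  · have : 0 ≤ k * (gaussA b μ μ + gaussA b ν ν - 2 * gaussA b μ ν) := by
      rw [key]; positivity
    have := nonneg_of_mul_nonneg_right this hk
    linarith
  · intro heq
    rw [heq, sub_self, mul_zero] at key
    have hcont : Continuous fun ξ => ‖charFun μ ξ - charFun ν ξ‖ ^ 2 :=
      (((charFun_cont μ).sub (charFun_cont ν)).norm.pow 2)
    have hint : Integrable (fun ξ => ‖charFun μ ξ - charFun ν ξ‖ ^ 2) γ := by
      apply Integrable.of_bound (C := 4) hcont.aestronglyMeasurable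
      refine Eventually.of_forall fun ξ => ?_
      have h1 := norm_sub_le (charFun μ ξ) (charFun ν ξ)
      have h2 := norm_charFun_le_one (μ := μ) ξ
      have h3 := norm_charFun_le_one (μ := ν) ξ
      rw [Real.norm_of_nonneg (by positivity)]
      nlinarith [norm_nonneg (charFun μ ξ - charFun ν ξ)]
    have h0 := (integral_eq_zero_iff_of_nonneg (fun ξ => by positivity) hint).1 key.symm
    have h1 := (hcont.ae_eq_iff_eq γ (by exact continuous_const)).1 h0
    apply Measure.ext_of_charFun
    ext ξ
    have := congrFun h1 ξ
    simpa [sub_eq_zero] using this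

end posdef

section mix
variable {E : Type*} [NormedAddCommGroup E] [InnerProductSpace ℝ E] [FiniteDimensional ℝ E]
  [MeasurableSpace E] [BorelSpace E]

/-- mixture of truncated Gaussians -/
def mixG (w : ℝ → ℝ≥0∞) (T s : ℝ) : ℝ≥0∞ :=
  ∫⁻ b in Set.Ioi (0:ℝ), w b * ENNReal.ofReal (Real.exp (-b * s ^ 2) - Real.exp (-b * T ^ 2))

lemma exp_diff_nonneg {b T s : ℝ} (hb : 0 < b) (hs : 0 ≤ s) (hsT : s ≤ T) :
    0 ≤ Real.exp (-b * s ^ 2) - Real.exp (-b * T ^ 2) := by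
  rw [sub_nonneg, Real.exp_le_exp]
  have : s ^ 2 ≤ T ^ 2 := by gcongr
  nlinarith

lemma gaussA_integrable (b : ℝ) (hb : 0 < b) (μ ν : Measure E) [IsProbabilityMeasure μ]
    [IsProbabilityMeasure ν] :
    Integrable (fun z : E × E => Real.exp (-b * ‖z.1 - z.2‖ ^ 2)) (μ.prod ν) := by
  apply Integrable.of_bound (C := 1)
  · exact (by fun_prop : Continuous _).aestronglyMeasurable
  · refine Eventually.of_forall fun z => ?_
    rw [Real.norm_of_nonneg (Real.exp_pos _).le, Real.exp_le_one_iff]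
    have : 0 ≤ ‖z.1 - z.2‖ ^ 2 := by positivity
    nlinarith

lemma ae_dist_le {K : Set E} {T : ℝ} (hKT : ∀ x ∈ K, ∀ y ∈ K, ‖x - y‖ ≤ T)
    (μ ν : Measure E) [IsProbabilityMeasure μ] [IsProbabilityMeasure ν]
    (hμ : μ Kᶜ = 0) (hν : ν Kᶜ = 0) : ∀ᵐ z ∂(μ.prod ν), ‖z.1 - z.2‖ ≤ T := by
  have h1 : ∀ᵐ z ∂(μ.prod ν), z.1 ∈ K :=
    Measure.quasiMeasurePreserving_fst.ae (p := fun x => x ∈ K) (by rw [ae_iff]; exact hμ)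
  have h2 : ∀ᵐ z ∂(μ.prod ν), z.2 ∈ K :=
    Measure.quasiMeasurePreserving_snd.ae (p := fun x => x ∈ K) (by rw [ae_iff]; exact hν)
  filter_upwards [h1, h2] with z hz1 hz2 using hKT _ hz1 _ hz2

lemma mix_eq (w : ℝ → ℝ≥0∞) (hw : Measurable w) {K : Set E} {T : ℝ}
    (hKT : ∀ x ∈ K, ∀ y ∈ K, ‖x - y‖ ≤ T)
    (μ ν : Measure E) [IsProbabilityMeasure μ] [IsProbabilityMeasure ν]
    (hμ : μ Kᶜ = 0) (hν : ν Kᶜ = 0) :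
    ∫⁻ z : E × E, mixG w T ‖z.1 - z.2‖ ∂(μ.prod ν) =
      ∫⁻ b in Set.Ioi (0:ℝ), w b * ENNReal.ofReal (gaussA b μ ν - Real.exp (-b * T ^ 2)) := by
  unfold mixG
  rw [lintegral_lintegral_swap]
  · apply setLIntegral_congr_fun measurableSet_Ioi
    intro b hb
    simp only
    have hmz : Measurable fun z : E × E => ENNReal.ofReal
        (Real.exp (-b * ‖z.1 - z.2‖ ^ 2) - Real.exp (-b * T ^ 2)) := by fun_prop
    rw [lintegral_const_mul _ hmz]
    congr 1
    have hi := gaussA_integrable b hb μ ν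
    have hi2 : Integrable (fun z : E × E => Real.exp (-b * ‖z.1 - z.2‖ ^ 2) -
        Real.exp (-b * T ^ 2)) (μ.prod ν) := hi.sub (integrable_const _)
    rw [← ofReal_integral_eq_lintegral_ofReal hi2]
    · congr 1
      rw [integral_sub hi (integrable_const _)]
      simp [gaussA]
    · filter_upwards [ae_dist_le hKT μ ν hμ hν] with z hz
      exact exp_diff_nonneg hb (norm_nonneg _) hz
  · refine Measurable.aemeasurable ?_
    have : Measurable fun p : (E × E) × ℝ => w p.2 := hw.comp measurable_snd
    refine this.mul ?_
    fun_prop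

lemma mix_convex (w : ℝ → ℝ≥0∞) (hw : Measurable w)
    (hw0 : ∀ b, 0 < b → w b ≠ 0) (hwt : ∀ b, 0 < b → w b ≠ ⊤) {K : Set E} {T : ℝ}
    (hKT : ∀ x ∈ K, ∀ y ∈ K, ‖x - y‖ ≤ T)
    (μ ν : Measure E) [IsProbabilityMeasure μ] [IsProbabilityMeasure ν]
    (hμ : μ Kᶜ = 0) (hν : ν Kᶜ = 0)
    (hfμ : ∫⁻ z : E × E, mixG w T ‖z.1 - z.2‖ ∂(μ.prod μ) ≠ ⊤)
    (hfν : ∫⁻ z : E × E, mixG w T ‖z.1 - z.2‖ ∂(ν.prod ν) ≠ ⊤)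
    (hle : ∫⁻ z : E × E, mixG w T ‖z.1 - z.2‖ ∂(μ.prod μ) +
      ∫⁻ z : E × E, mixG w T ‖z.1 - z.2‖ ∂(ν.prod ν) ≤
      2 * ∫⁻ z : E × E, mixG w T ‖z.1 - z.2‖ ∂(μ.prod ν)) : μ = ν := by
  rw [mix_eq w hw hKT _ _ hμ hμ] at hfμ hle
  rw [mix_eq w hw hKT _ _ hν hν] at hfν hle
  rw [mix_eq w hw hKT _ _ hμ hν] at hle
  have hAm : ∀ (μ ν : Measure E) [IsProbabilityMeasure μ] [IsProbabilityMeasure ν],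
      Measurable (fun b : ℝ => w b * ENNReal.ofReal (gaussA b μ ν - Real.exp (-b * T ^ 2))) := by
    intro μ ν _ _
    refine hw.mul ?_
    have : Measurable fun b => gaussA b μ ν := by
      unfold gaussA
      refine StronglyMeasurable.measurable ?_
      apply StronglyMeasurable.integral_prod_right
      exact (by fun_prop : Continuous _).stronglyMeasurable
    fun_prop
  have hge : ∀ (μ ν : Measure E) [IsProbabilityMeasure μ] [IsProbabilityMeasure ν],
      μ Kᶜ = 0 → ν Kᶜ = 0 → ∀ b : ℝ, 0 < b → 0 ≤ gaussA b μ ν - Real.exp (-b * T ^ 2) := by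
    intro μ ν _ _ hμ hν b hb
    have hi := gaussA_integrable b hb μ ν
    have : gaussA b μ ν - Real.exp (-b * T ^ 2) =
        ∫ z : E × E, (Real.exp (-b * ‖z.1 - z.2‖ ^ 2) - Real.exp (-b * T ^ 2)) ∂(μ.prod ν) := by
      rw [integral_sub hi (integrable_const _)]
      simp [gaussA]
    rw [this]
    apply integral_nonneg_of_ae
    filter_upwards [ae_dist_le hKT μ ν hμ hν] with z hz
    exact exp_diff_nonneg hb (norm_nonneg _) hz
  rw [← lintegral_const_mul _ (hAm μ ν), ← lintegral_add_left (hAm μ μ)] at hle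
  have hpt : ∀ᵐ b ∂(volume.restrict (Set.Ioi (0:ℝ))),
      2 * (w b * ENNReal.ofReal (gaussA b μ ν - Real.exp (-b * T ^ 2))) ≤
      w b * ENNReal.ofReal (gaussA b μ μ - Real.exp (-b * T ^ 2)) +
      w b * ENNReal.ofReal (gaussA b ν ν - Real.exp (-b * T ^ 2)) := by
    filter_upwards [ae_restrict_mem measurableSet_Ioi] with b hb
    rw [← mul_add, ← ENNReal.ofReal_add (hge _ _ hμ hμ b hb) (hge _ _ hν hν b hb), mul_left_comm]
    gcongr
    rw [show (2 : ℝ≥0∞) = ENNReal.ofReal 2 by simp, ← ENNReal.ofReal_mul (by norm_num)]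
    apply ENNReal.ofReal_le_ofReal
    have := (gaussA_posdef b hb μ ν).1
    linarith
  have hfin : ∫⁻ b in Set.Ioi (0:ℝ),
      2 * (w b * ENNReal.ofReal (gaussA b μ ν - Real.exp (-b * T ^ 2))) ≠ ⊤ := by
    refine ne_top_of_le_ne_top ?_ (lintegral_mono_ae hpt)
    rw [lintegral_add_left (hAm μ μ)]
    exact ENNReal.add_ne_top.2 ⟨hfμ, hfν⟩
  have hae := ae_eq_of_ae_le_of_lintegral_le hpt hfin
    ((hAm μ μ).add (hAm ν ν)).aemeasurable hle
  have hne : (ae (volume.restrict (Set.Ioi (0:ℝ)))).NeBot := by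
    rw [ae_neBot]
    intro h
    rw [Measure.restrict_eq_zero] at h
    simp at h
  obtain ⟨b, hb, hb0⟩ := (hae.and (ae_restrict_mem measurableSet_Ioi)).exists
  refine (gaussA_posdef b hb0 μ ν).2 ?_
  beta_reduce at hb
  rw [← mul_add, ← ENNReal.ofReal_add (hge _ _ hμ hμ b hb0) (hge _ _ hν hν b hb0), mul_left_comm,
    show (2 : ℝ≥0∞) = ENNReal.ofReal 2 by simp, ← ENNReal.ofReal_mul (by norm_num),
    ENNReal.mul_right_inj (hw0 b hb0) (hwt b hb0),
    ENNReal.ofReal_eq_ofReal_iff (mul_nonneg (by norm_num) (hge _ _ hμ hν b hb0))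
      (add_nonneg (hge _ _ hμ hμ b hb0) (hge _ _ hν hν b hb0))] at hb
  linarith

end mix

section kern

/-- radial Coulomb profile -/
def gRad (d : ℕ) (r : ℝ) : ℝ :=
  if d = 2 then Real.log (1 / r) else 1 / (((d : ℝ) - 2) * r ^ ((d : ℕ) - 2))

/-- mixing weight -/
def wK (d : ℕ) (b : ℝ) : ℝ≥0∞ :=
  ENNReal.ofReal (b ^ ((d : ℝ) / 2 - 2) / (2 * Real.Gamma ((d : ℝ) / 2)))

lemma wK_meas (d : ℕ) : Measurable (wK d) := by
  unfold wK; fun_prop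

lemma wK_ne_zero (d : ℕ) (hd : 2 ≤ d) (b : ℝ) (hb : 0 < b) : wK d b ≠ 0 := by
  unfold wK
  have : 0 < Real.Gamma ((d : ℝ) / 2) := Real.Gamma_pos_of_pos (by positivity)
  have h2 : 0 < b ^ ((d : ℝ) / 2 - 2) := Real.rpow_pos_of_pos hb _
  rw [ne_eq, ENNReal.ofReal_eq_zero, not_le]
  positivity

lemma wK_ne_top (d : ℕ) (b : ℝ) : wK d b ≠ ⊤ := ENNReal.ofReal_ne_top

lemma gRad_sub (d : ℕ) (hd : 2 ≤ d) {r T : ℝ} (hr : 0 < r) (hrT : r ≤ T) :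
    ∫⁻ u in Set.Ioc (r ^ 2) (T ^ 2), ENNReal.ofReal (u ^ (-((d : ℝ) / 2)) / 2) =
      ENNReal.ofReal (gRad d r - gRad d T) := by
  have hT : 0 < T := hr.trans_le hrT
  have hsq : r ^ 2 ≤ T ^ 2 := by gcongr
  have h0 : (0:ℝ) ∉ Set.uIcc (r ^ 2) (T ^ 2) := by
    rw [Set.uIcc_of_le hsq]
    intro h
    have := h.1
    have : 0 < r ^ 2 := by positivity
    linarith
  have hii : IntervalIntegrable (fun u : ℝ => u ^ (-((d : ℝ) / 2)) / 2) volume (r ^ 2) (T ^ 2) :=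
    (intervalIntegral.intervalIntegrable_rpow (Or.inr h0)).div_const _
  rw [← ofReal_integral_eq_lintegral_ofReal]
  · rw [← intervalIntegral.integral_of_le hsq]
    congr 1
    rw [intervalIntegral.integral_div]
    unfold gRad
    split_ifs with h
    · subst h
      have : (fun u : ℝ => u ^ (-(((2:ℕ) : ℝ) / 2))) = fun u => u⁻¹ := by
        funext u
        norm_num [Real.rpow_neg_one]
      rw [this, integral_inv_of_pos (by positivity) (by positivity), ← div_pow, Real.log_pow,
        Real.log_div hT.ne' hr.ne']
      simp
      ring
    · have hd3 : (3:ℝ) ≤ d := by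
        have : 3 ≤ d := by omega
        exact_mod_cast this
      rw [integral_rpow (Or.inr ⟨by intro h; linarith, h0⟩)]
      have hp : ∀ x : ℝ, 0 < x → (x ^ 2) ^ (-((d : ℝ) / 2) + 1) = (x ^ (d - 2))⁻¹ := by
        intro x hx
        rw [← Real.rpow_natCast x 2, ← Real.rpow_mul hx.le, ← Real.rpow_natCast,
          ← Real.rpow_neg hx.le]
        congr 1
        push_cast [hd]
        ring
      rw [hp r hr, hp T hT]
      have h1 : (d:ℝ) - 2 ≠ 0 := by intro h; linarith
      have h2 : -((d:ℝ) / 2) + 1 = -((d:ℝ) - 2) / 2 := by ring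
      have h3 : r ^ (d - 2) ≠ 0 := by positivity
      have h4 : T ^ (d - 2) ≠ 0 := by positivity
      rw [h2]
      field_simp
      ring
  · exact hii.1
  · filter_upwards [ae_restrict_mem measurableSet_Ioc] with u hu
    have : 0 ≤ u := (sq_nonneg r).trans hu.1.le
    simp only [Pi.zero_apply]
    positivity

lemma gamma_rep (d : ℕ) (hd : 2 ≤ d) {u : ℝ} (hu : 0 < u) :
    ENNReal.ofReal (u ^ (-((d : ℝ) / 2)) / 2) = ∫⁻ b in Set.Ioi (0:ℝ),
      ENNReal.ofReal (b ^ ((d : ℝ) / 2 - 1) * Real.exp (-(u * b)) / (2 * Real.Gamma ((d : ℝ) / 2))) := by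
  have hG : 0 < Real.Gamma ((d : ℝ) / 2) := Real.Gamma_pos_of_pos (by positivity)
  have hI := Real.integral_rpow_mul_exp_neg_mul_Ioi (a := (d:ℝ)/2) (r := u) (by positivity) hu
  have hint : IntegrableOn (fun b : ℝ => b ^ ((d : ℝ) / 2 - 1) * Real.exp (-(u * b))) (Set.Ioi 0) := by
    by_contra h
    rw [integral_undef h] at hI
    have : 0 < (1 / u) ^ ((d:ℝ)/2) * Real.Gamma ((d:ℝ)/2) := by positivity
    linarith
  rw [← ofReal_integral_eq_lintegral_ofReal]
  · rw [integral_div, hI, one_div, Real.inv_rpow hu.le, Real.rpow_neg hu.le]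
    congr 1
    field_simp
  · exact hint.div_const _
  · filter_upwards [ae_restrict_mem measurableSet_Ioi] with b hb
    simp only [Pi.zero_apply]
    have : 0 < b ^ ((d:ℝ)/2-1) := Real.rpow_pos_of_pos hb _
    positivity

lemma exp_rep {b s S : ℝ} (hb : 0 < b) (hs : s ≤ S) :
    ∫⁻ u in Set.Ioc s S, ENNReal.ofReal (Real.exp (-(u * b))) =
      ENNReal.ofReal ((Real.exp (-b * s) - Real.exp (-b * S)) / b) := by
  rw [← ofReal_integral_eq_lintegral_ofReal]
  · rw [← intervalIntegral.integral_of_le hs]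
    congr 1
    have : ∀ u ∈ Set.uIcc s S, HasDerivAt (fun u : ℝ => -(Real.exp (-(u * b)) / b))
        (Real.exp (-(u * b))) u := by
      intro u _
      have h1 : HasDerivAt (fun u : ℝ => -(u * b)) (-(1 * b)) u :=
        ((hasDerivAt_id u).mul_const b).neg
      have h2 := (h1.exp.div_const b).neg
      have e : -(Real.exp (-(u * b)) * -(1 * b) / b) = Real.exp (-(u * b)) := by
        field_simp
      rw [e] at h2
      exact h2
    rw [intervalIntegral.integral_eq_sub_of_hasDerivAt this
      ((by fun_prop : Continuous fun u : ℝ => Real.exp (-(u * b))).intervalIntegrable _ _)]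
    have e1 : -(S * b) = -b * S := by ring
    have e2 : -(s * b) = -b * s := by ring
    rw [e1, e2]
    ring
  · exact ((by fun_prop : Continuous fun u : ℝ => Real.exp (-(u * b))).intervalIntegrable s S).1
  · exact Eventually.of_forall fun u => (Real.exp_pos _).le

lemma mixG_eq (d : ℕ) (hd : 2 ≤ d) {s T : ℝ} (hs : 0 ≤ s) (hsT : s ≤ T) :
    mixG (wK d) T s =
      ∫⁻ u in Set.Ioc (s ^ 2) (T ^ 2), ENNReal.ofReal (u ^ (-((d : ℝ) / 2)) / 2) := by
  have hG : 0 < Real.Gamma ((d : ℝ) / 2) := Real.Gamma_pos_of_pos (by positivity)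
  have h1 : ∫⁻ u in Set.Ioc (s ^ 2) (T ^ 2), ENNReal.ofReal (u ^ (-((d : ℝ) / 2)) / 2) =
      ∫⁻ u in Set.Ioc (s ^ 2) (T ^ 2), ∫⁻ b in Set.Ioi (0:ℝ),
      ENNReal.ofReal (b ^ ((d : ℝ) / 2 - 1) * Real.exp (-(u * b)) / (2 * Real.Gamma ((d : ℝ) / 2))) := by
    apply setLIntegral_congr_fun measurableSet_Ioc
    intro u hu
    exact gamma_rep d hd ((sq_nonneg s).trans_lt hu.1)
  rw [h1, lintegral_lintegral_swap (by fun_prop)]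
  unfold mixG
  apply setLIntegral_congr_fun measurableSet_Ioi
  intro b hb
  have hb' : 0 < b := hb
  have hsq : s ^ 2 ≤ T ^ 2 := by gcongr
  have h2 : ∀ u : ℝ, ENNReal.ofReal (b ^ ((d : ℝ) / 2 - 1) * Real.exp (-(u * b)) /
      (2 * Real.Gamma ((d : ℝ) / 2))) = ENNReal.ofReal (b ^ ((d : ℝ) / 2 - 1) /
      (2 * Real.Gamma ((d : ℝ) / 2))) * ENNReal.ofReal (Real.exp (-(u * b))) := by
    intro u
    rw [← ENNReal.ofReal_mul (by positivity)]
    congr 1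
    ring
  simp only [h2]
  rw [lintegral_const_mul _ (by fun_prop), exp_rep hb' hsq, wK,
    ← ENNReal.ofReal_mul (by positivity), ← ENNReal.ofReal_mul (by positivity)]
  congr 1
  have : b ^ ((d : ℝ) / 2 - 1) = b ^ ((d : ℝ) / 2 - 2) * b := by
    rw [← Real.rpow_add_one hb'.ne']
    congr 1
    ring
  rw [this]
  field_simp

lemma gRad_tendsto (d : ℕ) (hd : 2 ≤ d) : Tendsto (gRad d) (𝓝[>] 0) atTop := by
  unfold gRad
  split_ifs with h
  · have := Real.tendsto_log_nhdsGT_zero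
    simp only [one_div, Real.log_inv]
    exact tendsto_neg_atBot_atTop.comp this
  · have hd3 : (3:ℝ) ≤ d := by
      have : 3 ≤ d := by omega
      exact_mod_cast this
    have h1 : Tendsto (fun r : ℝ => ((d:ℝ) - 2) * r ^ (d - 2)) (𝓝[>] 0) (𝓝[>] 0) := by
      rw [tendsto_nhdsWithin_iff]
      constructor
      · have : Continuous fun r : ℝ => ((d:ℝ) - 2) * r ^ (d - 2) := by fun_prop
        have h2 := this.tendsto 0
        rw [zero_pow (by omega), mul_zero] at h2
        exact h2.mono_left nhdsWithin_le_nhds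
      · filter_upwards [self_mem_nhdsWithin] with r hr
        have hr' : 0 < r := hr
        have : 0 < (d:ℝ) - 2 := by linarith
        simp only [Set.mem_Ioi]
        positivity
    simp only [one_div]
    exact tendsto_inv_nhdsGT_zero.comp h1

lemma mixG_zero (d : ℕ) (hd : 2 ≤ d) {T : ℝ} (hT : 0 < T) : mixG (wK d) T 0 = ⊤ := by
  rw [mixG_eq d hd le_rfl hT.le]
  refine ENNReal.eq_top_of_forall_nnreal_le fun L => ?_
  have h1 := (gRad_tendsto d hd).eventually (eventually_ge_atTop (L + gRad d T))
  have h2 : ∀ᶠ r in 𝓝[>] (0:ℝ), r ∈ Set.Ioc 0 T := Ioc_mem_nhdsGT hT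
  obtain ⟨r, hr1, hr2⟩ := (h1.and h2).exists
  calc (L : ℝ≥0∞) = ENNReal.ofReal L := by simp
    _ ≤ ENNReal.ofReal (gRad d r - gRad d T) := ENNReal.ofReal_le_ofReal (by linarith)
    _ = _ := (gRad_sub d hd hr2.1 hr2.2).symm
    _ ≤ _ := lintegral_mono_set (Set.Ioc_subset_Ioc_left (by nlinarith [sq_nonneg r]))

lemma gRad_anti (d : ℕ) (hd : 2 ≤ d) {r T : ℝ} (hr : 0 < r) (hrT : r ≤ T) :
    gRad d T ≤ gRad d r := by
  unfold gRad
  split_ifs with h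
  · apply Real.log_le_log
    · have := hr.trans_le hrT
      positivity
    · exact one_div_le_one_div_of_le hr hrT
  · have hd3 : (3:ℝ) ≤ d := by
      have : 3 ≤ d := by omega
      exact_mod_cast this
    have : 0 < (d:ℝ) - 2 := by linarith
    apply one_div_le_one_div_of_le (by positivity)
    gcongr

lemma coulombK_ne (d : ℕ) {x : Euc d} (hx : x ≠ 0) : coulombK d x = ((gRad d ‖x‖ : ℝ) : EReal) := by
  unfold coulombK gRad
  rw [if_neg hx]
  split_ifs <;> rfl

lemma coulombK_rep (d : ℕ) (hd : 2 ≤ d) {T : ℝ} (hT : 0 < T) {x : Euc d} (hx : ‖x‖ ≤ T) :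
    coulombK d x = ((gRad d T : ℝ) : EReal) + ((mixG (wK d) T ‖x‖ : ℝ≥0∞) : EReal) := by
  by_cases h : x = 0
  · subst h
    rw [norm_zero, mixG_zero d hd hT]
    simp [coulombK]
  · have hp : 0 < ‖x‖ := norm_pos_iff.2 h
    rw [coulombK_ne d h, mixG_eq d hd hp.le hx, gRad_sub d hd hp hx, EReal.coe_ennreal_ofReal,
      max_eq_left (sub_nonneg.2 (gRad_anti d hd hp hx)), ← EReal.coe_add]
    congr 1
    ring

end kern

section energ

/-- the energy integrand -/
def FF (d : ℕ) (V : Euc d → ℝ) (z : Euc d × Euc d) : EReal :=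
  coulombK d (z.1 - z.2) + (((V z.1 + V z.2) / 2 : ℝ) : EReal)

/-- shifted positive integrand -/
def HC (d : ℕ) (V : Euc d → ℝ) (C : ℝ) (z : Euc d × Euc d) : ℝ≥0∞ :=
  posP (FF d V z + (C : EReal))

lemma posP_eq (x : EReal) : posP x = x.toENNReal := rfl

lemma posP_mono {x y : EReal} (h : x ≤ y) : posP x ≤ posP y := by
  rw [posP_eq, posP_eq]; exact EReal.toENNReal_le_toENNReal h

lemma posP_coe (x : ℝ) : posP (x : EReal) = ENNReal.ofReal x := by
  unfold posP; simp

lemma coulombK_lsc (d : ℕ) (hd : 2 ≤ d) : LowerSemicontinuous (coulombK d) := by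
  intro x
  by_cases hx : x = 0
  · subst hx
    intro y hy
    have h0 : coulombK d 0 = ⊤ := by simp [coulombK]
    rw [h0] at hy
    obtain ⟨L, hyL, -⟩ := EReal.lt_iff_exists_real_btwn.1 hy
    have h1 := (gRad_tendsto d hd).eventually (eventually_ge_atTop L)
    rw [eventually_nhdsWithin_iff] at h1
    have h2 : Tendsto (fun x : Euc d => ‖x‖) (𝓝 0) (𝓝 0) := by
      simpa using (continuous_norm (E := Euc d)).tendsto 0
    filter_upwards [h2.eventually h1] with x hx
    by_cases hx0 : x = 0
    · subst hx0; rw [h0]; exact hy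
    · rw [coulombK_ne d hx0]
      exact hyL.trans_le (EReal.coe_le_coe_iff.2 (hx (norm_pos_iff.2 hx0)))
  · refine ContinuousAt.lowerSemicontinuousAt ?_
    have h1 : (fun x : Euc d => ((gRad d ‖x‖ : ℝ) : EReal)) =ᶠ[𝓝 x] coulombK d := by
      filter_upwards [isOpen_ne.mem_nhds hx] with y hy
      exact (coulombK_ne d hy).symm
    refine ContinuousAt.congr ?_ h1
    refine continuous_coe_real_ereal.continuousAt.comp ?_
    have hn : ‖x‖ ≠ 0 := norm_ne_zero_iff.2 hx
    unfold gRad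
    split_ifs with h
    · apply ContinuousAt.log
      · fun_prop (disch := assumption)
      · positivity
    · have : (d:ℝ) - 2 ≠ 0 := by
        have : 3 ≤ d := by omega
        have : (3:ℝ) ≤ d := by exact_mod_cast this
        intro h; linarith
      apply ContinuousAt.div (by fun_prop) (by fun_prop)
      positivity

lemma FF_lsc (d : ℕ) (hd : 2 ≤ d) (V : Euc d → ℝ) (hV : LowerSemicontinuous V) :
    LowerSemicontinuous (FF d V) := by
  unfold FF
  apply LowerSemicontinuous.add'
  · exact (coulombK_lsc d hd).comp (continuous_fst.sub continuous_snd)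
  · apply continuous_coe_real_ereal.comp_lowerSemicontinuous _ EReal.coe_strictMono.monotone
    have h1 : LowerSemicontinuous fun z : Euc d × Euc d => V z.1 + V z.2 :=
      (hV.comp continuous_fst).add (hV.comp continuous_snd)
    exact (continuous_id.div_const (2:ℝ)).comp_lowerSemicontinuous h1
      (fun a b h => by simp only [id]; linarith)
  · intro z
    exact EReal.continuousAt_add (Or.inr (by simp)) (Or.inr (by simp))

lemma HC_lsc (d : ℕ) (hd : 2 ≤ d) (V : Euc d → ℝ) (hV : LowerSemicontinuous V) (C : ℝ) :
    LowerSemicontinuous (HC d V C) := by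
  unfold HC
  have h1 : LowerSemicontinuous fun z => FF d V z + (C : EReal) := by
    apply LowerSemicontinuous.add' (FF_lsc d hd V hV) lowerSemicontinuous_const
    intro z
    exact EReal.continuousAt_add (Or.inr (by simp)) (Or.inr (by simp))
  exact EReal.continuous_toENNReal.comp_lowerSemicontinuous h1 (fun a b h => posP_mono h)

lemma coulombK_ge (d : ℕ) (hd : 2 ≤ d) (x : Euc d) : ((-‖x‖ : ℝ) : EReal) ≤ coulombK d x := by
  by_cases hx : x = 0
  · simp [coulombK, hx]
  · rw [coulombK_ne d hx, EReal.coe_le_coe_iff]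
    have hp : 0 < ‖x‖ := norm_pos_iff.2 hx
    unfold gRad
    split_ifs with h
    · rw [one_div, Real.log_inv]
      have := Real.log_le_sub_one_of_pos hp
      linarith
    · have : 3 ≤ d := by omega
      have : (3:ℝ) ≤ d := by exact_mod_cast this
      have : 0 < (d:ℝ) - 2 := by linarith
      have : 0 < 1 / (((d:ℝ) - 2) * ‖x‖ ^ (d - 2)) := by positivity
      linarith

lemma FF_ge (d : ℕ) (hd : 2 ≤ d) (V : Euc d → ℝ) (a q R : ℝ) (hg : GrowthCond d V a q R)
    (z : Euc d × Euc d) :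
    (((a / 2 * ‖z.1‖ ^ q - ‖z.1‖ - R / 2) + (a / 2 * ‖z.2‖ ^ q - ‖z.2‖ - R / 2) : ℝ) : EReal)
      ≤ FF d V z := by
  unfold FF
  calc _ ≤ ((-‖z.1 - z.2‖ : ℝ) : EReal) + (((V z.1 + V z.2) / 2 : ℝ) : EReal) := by
        rw [← EReal.coe_add, EReal.coe_le_coe_iff]
        have h1 := hg z.1
        have h2 := hg z.2
        have h3 := norm_sub_le z.1 z.2
        linarith
    _ ≤ _ := by gcongr; exact coulombK_ge d hd _

lemma phi_prop (a q R : ℝ) (ha : 0 < a) (hq : 1 < q) :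
    (∃ m : ℝ, ∀ r : ℝ, 0 ≤ r → m ≤ a / 2 * r ^ q - r - R / 2) ∧
    ∀ L : ℝ, ∃ ρ : ℝ, ∀ r : ℝ, 0 ≤ r → ρ < r → L ≤ a / 2 * r ^ q - r - R / 2 := by
  have ht : Tendsto (fun r : ℝ => r * (a / 2 * r ^ (q - 1) - 1)) atTop atTop := by
    apply tendsto_id.atTop_mul_atTop₀
    apply tendsto_atTop_add_const_right
    exact (tendsto_rpow_atTop (by linarith)).const_mul_atTop (by positivity)
  have h2 : ∀ L : ℝ, ∃ ρ : ℝ, ∀ r : ℝ, 0 ≤ r → ρ < r → L ≤ a / 2 * r ^ q - r - R / 2 := by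
    intro L
    obtain ⟨ρ, hρ⟩ := (eventually_atTop.1 (ht.eventually (eventually_ge_atTop (L + R / 2))))
    refine ⟨max ρ 0, fun r _ hr => ?_⟩
    have h1 := hρ r ((le_max_left _ _).trans hr.le)
    have hr0 : 0 < r := (le_max_right _ _).trans_lt hr
    have : r ^ q = r * r ^ (q - 1) := by
      rw [mul_comm, ← Real.rpow_add_one hr0.ne']
      congr 1; ring
    rw [this]
    linarith
  refine ⟨?_, h2⟩
  obtain ⟨ρ, hρ⟩ := h2 0
  refine ⟨min 0 (-ρ - R / 2), fun r hr => ?_⟩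
  by_cases h : ρ < r
  · exact (min_le_left _ _).trans (hρ r hr h)
  · refine (min_le_right _ _).trans ?_
    have : 0 ≤ r ^ q := Real.rpow_nonneg hr _
    have : 0 ≤ a / 2 * r ^ q := by positivity
    linarith

lemma HC_ge (d : ℕ) (V : Euc d → ℝ) (C l : ℝ) (z : Euc d × Euc d) (h : (l : EReal) ≤ FF d V z) :
    ENNReal.ofReal (l + C) ≤ HC d V C z := by
  unfold HC
  rw [← posP_coe, EReal.coe_add]
  apply posP_mono
  gcongr

lemma HC_coer (d : ℕ) (hd : 2 ≤ d) (V : Euc d → ℝ) (a q R : ℝ) (ha : 0 < a) (hq : 1 < q)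
    (hg : GrowthCond d V a q R) (C : ℝ) : Coer (HC d V C) := by
  obtain ⟨⟨m, hm⟩, hL⟩ := phi_prop a q R ha hq
  intro L
  obtain ⟨ρ, hρ⟩ := hL (L - C - m)
  refine ⟨closedBall 0 ρ, isCompact_closedBall _ _, fun z hz => ?_⟩
  refine le_trans ?_ (HC_ge d V C _ z (FF_ge d hd V a q R hg z))
  rw [← ENNReal.ofReal_coe_nnreal]
  apply ENNReal.ofReal_le_ofReal
  simp only [mem_closedBall, dist_zero_right, not_le] at hz
  have h1 := hm _ (norm_nonneg z.1)
  have h2 := hm _ (norm_nonneg z.2)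
  rcases hz with hz | hz
  · have := hρ _ (norm_nonneg z.1) hz
    linarith
  · have := hρ _ (norm_nonneg z.2) hz
    linarith

lemma FF_bdd (d : ℕ) (hd : 2 ≤ d) (V : Euc d → ℝ) (a q R : ℝ) (ha : 0 < a) (hq : 1 < q)
    (hg : GrowthCond d V a q R) : ∃ C0 : ℝ, 0 ≤ C0 ∧ ∀ z, ((-C0 : ℝ) : EReal) ≤ FF d V z := by
  obtain ⟨⟨m, hm⟩, hL⟩ := phi_prop a q R ha hq
  refine ⟨max 0 (-(2 * m)), le_max_left _ _, fun z => le_trans ?_ (FF_ge d hd V a q R hg z)⟩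
  rw [EReal.coe_le_coe_iff]
  have h1 := hm _ (norm_nonneg z.1)
  have h2 := hm _ (norm_nonneg z.2)
  have := le_max_right 0 (-(2 * m))
  linarith

lemma FF_ne_bot (d : ℕ) (hd : 2 ≤ d) (V : Euc d → ℝ) (z : Euc d × Euc d) : FF d V z ≠ ⊥ := by
  unfold FF
  have h := coulombK_ge d hd (z.1 - z.2)
  intro hb
  rw [EReal.add_eq_bot_iff] at hb
  rcases hb with hb | hb
  · rw [hb] at h; simp at h
  · simp at hb

lemma posP_pt (C : ℝ) (x : EReal) (h : ((-C : ℝ) : EReal) ≤ x) (hC : 0 ≤ C) :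
    posP (x + (C : EReal)) + posP (-x) = posP x + ENNReal.ofReal C := by
  induction x with
  | bot => simp at h
  | top => simp [posP]
  | coe f =>
    rw [EReal.coe_le_coe_iff] at h
    rw [← EReal.coe_add, ← EReal.coe_neg, posP_coe, posP_coe, posP_coe]
    rcases le_total 0 f with hf | hf
    · rw [ENNReal.ofReal_add hf hC, ENNReal.ofReal_of_nonpos (by linarith : -f ≤ 0), add_zero]
    · rw [ENNReal.ofReal_of_nonpos hf, zero_add, ← ENNReal.ofReal_add (by linarith) (by linarith)]
      congr 1; ring

lemma posP_neg_le (C : ℝ) (x : EReal) (h : ((-C : ℝ) : EReal) ≤ x) :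
    posP (-x) ≤ ENNReal.ofReal C := by
  rw [← posP_coe]
  apply posP_mono
  rw [EReal.neg_le]
  simpa using h

lemma energy_eq (d : ℕ) (hd : 2 ≤ d) (V : Euc d → ℝ) (hV : LowerSemicontinuous V) (C : ℝ)
    (hC : 0 ≤ C) (hb : ∀ z, ((-C : ℝ) : EReal) ≤ FF d V z) (μ : Measure (Euc d))
    [IsProbabilityMeasure μ] :
    energy d V μ = ((∫⁻ z, HC d V C z ∂(μ.prod μ) : ℝ≥0∞) : EReal) - ((C : ℝ) : EReal) := by
  have hF : Measurable (FF d V) := (FF_lsc d hd V hV).measurable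
  have hm1 : Measurable fun z => posP (FF d V z) := EReal.continuous_toENNReal.measurable.comp hF
  have hm2 : Measurable fun z => posP (-FF d V z) := EReal.continuous_toENNReal.measurable.comp hF.neg
  have hm3 : Measurable (HC d V C) := (HC_lsc d hd V hV C).measurable
  have key : ∫⁻ z, HC d V C z ∂(μ.prod μ) + ∫⁻ z, posP (-FF d V z) ∂(μ.prod μ) =
      ∫⁻ z, posP (FF d V z) ∂(μ.prod μ) + ENNReal.ofReal C := by
    rw [← lintegral_add_left hm3]
    have : ENNReal.ofReal C = ∫⁻ _, ENNReal.ofReal C ∂(μ.prod μ) := by simp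
    rw [this, ← lintegral_add_left hm1]
    exact lintegral_congr fun z => posP_pt C _ (hb z) hC
  have hB : ∫⁻ z, posP (-FF d V z) ∂(μ.prod μ) ≠ ⊤ := by
    refine ne_top_of_le_ne_top ENNReal.ofReal_ne_top (b := ENNReal.ofReal C) ?_
    calc _ ≤ ∫⁻ _, ENNReal.ofReal C ∂(μ.prod μ) :=
          lintegral_mono fun z => posP_neg_le C _ (hb z)
      _ = _ := by simp
  change ((∫⁻ z, posP (FF d V z) ∂(μ.prod μ) : ℝ≥0∞) : EReal) -
    ((∫⁻ z, posP (-FF d V z) ∂(μ.prod μ) : ℝ≥0∞) : EReal) = _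
  generalize (∫⁻ z, posP (-FF d V z) ∂(μ.prod μ)) = B at *
  generalize (∫⁻ z, posP (FF d V z) ∂(μ.prod μ)) = P at *
  generalize (∫⁻ z, HC d V C z ∂(μ.prod μ)) = A at *
  lift B to ℝ≥0 using hB
  by_cases hP : P = ⊤
  · subst hP
    have hA : A = ⊤ := by
      by_contra hA
      lift A to ℝ≥0 using hA
      rw [top_add] at key
      exact absurd key (by exact_mod_cast ENNReal.coe_ne_top (r := A + B))
    subst hA
    rw [EReal.coe_ennreal_top, EReal.top_sub_coe]
    exact EReal.top_sub_coe (B : ℝ)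
  · have hA : A ≠ ⊤ := by
      intro hA
      rw [hA, top_add] at key
      exact (ENNReal.add_ne_top.2 ⟨hP, ENNReal.ofReal_ne_top⟩) key.symm
    lift A to ℝ≥0 using hA
    lift P to ℝ≥0 using hP
    have key2 : (A:ℝ) + B = P + C := by
      have := congrArg ENNReal.toReal key
      rw [ENNReal.toReal_add (by simp) (by simp), ENNReal.toReal_add (by simp) (by simp),
        ENNReal.toReal_ofReal hC] at this
      simpa using this
    change ((P:ℝ) : EReal) - ((B:ℝ) : EReal) = ((A:ℝ) : EReal) - ((C:ℝ) : EReal)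
    rw [← EReal.coe_sub, ← EReal.coe_sub]
    congr 1
    linarith

end energ

section finite

lemma posP_add_le (x y : EReal) : posP (x + y) ≤ posP x + posP y := EReal.toENNReal_add_le

lemma kball_finite (d : ℕ) (hd : 2 ≤ d) :
    ∫⁻ y in ball (0 : Euc d) 2, posP (coulombK d y) ≠ ⊤ := by
  have : Nonempty (Fin d) := ⟨⟨0, by omega⟩⟩
  have : Nontrivial (Euc d) := inferInstance
  have hi : IntegrableOn (fun y : Euc d => 2 * (‖y‖ ^ (d - 1))⁻¹) (ball 0 2) := by
    have : Integrable (fun y : Euc d =>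
        (fun r : ℝ => (Set.Iio (2:ℝ)).indicator (fun r => 2 * (r ^ (d - 1))⁻¹) r) ‖y‖) := by
      rw [integrable_fun_norm_addHaar]
      have hfr : Module.finrank ℝ (Euc d) = d := by simp
      rw [hfr]
      have h1 : IntegrableOn (fun r : ℝ => (Set.Ioo (0:ℝ) 2).indicator (fun _ => (2:ℝ)) r)
          (Set.Ioi 0) := by
        apply Integrable.integrableOn
        rw [integrable_indicator_iff measurableSet_Ioo]
        exact integrableOn_const (by simp)
      refine h1.congr_fun ?_ measurableSet_Ioi
      intro r hr
      have hr' : (0:ℝ) < r := hr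
      by_cases h : r < 2
      · simp only [Set.indicator, Set.mem_Ioo, Set.mem_Iio, h, hr', and_self, if_true, smul_eq_mul]
        field_simp
      · simp [Set.indicator, h]
    rw [← integrable_indicator_iff measurableSet_ball]
    refine this.congr (Eventually.of_forall fun y => ?_)
    simp [Set.indicator]
  refine ne_top_of_le_ne_top hi.lintegral_lt_top.ne ?_
  have hae : ∀ᵐ y : Euc d ∂volume, y ≠ 0 := by
    rw [ae_iff]; simp
  apply lintegral_mono_ae
  filter_upwards [ae_restrict_mem measurableSet_ball, ae_restrict_of_ae hae] with y hy hy0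
  rw [coulombK_ne d hy0, posP_coe]
  apply ENNReal.ofReal_le_ofReal
  have hp : 0 < ‖y‖ := norm_pos_iff.2 hy0
  have h2 : ‖y‖ < 2 := by simpa using hy
  unfold gRad
  split_ifs with h
  · subst h
    have : Real.log (1 / ‖y‖) ≤ 1 / ‖y‖ - 1 := Real.log_le_sub_one_of_pos (by positivity)
    have h3 : 0 < ‖y‖⁻¹ := by positivity
    simp only [Nat.add_one_sub_one, pow_one, one_div] at *
    linarith
  · have h3 : 3 ≤ d := by omega
    have h3' : (3:ℝ) ≤ d := by exact_mod_cast h3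
    have e : d - 1 = (d - 2) + 1 := by omega
    rw [e, pow_succ]
    have hpp : 0 < ‖y‖ ^ (d - 2) := by positivity
    rw [← div_eq_mul_inv, div_le_div_iff₀ (by nlinarith) (by positivity)]
    nlinarith

lemma exists_finite (d : ℕ) (hd : 2 ≤ d) (V : Euc d → ℝ) (hV : LowerSemicontinuous V) (C : ℝ) :
    ∃ μ : Measure (Euc d), IsProbabilityMeasure μ ∧ ∫⁻ z, HC d V C z ∂(μ.prod μ) ≠ ⊤ := by
  have hVm : Measurable V := hV.measurable
  obtain ⟨n, hn⟩ : ∃ n : ℕ, volume ({x | V x ≤ n} ∩ ball (0 : Euc d) 1) ≠ 0 := by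
    by_contra! hcon
    have h1 : volume (⋃ n : ℕ, {x | V x ≤ n} ∩ ball (0 : Euc d) 1) = 0 :=
      measure_iUnion_null hcon
    rw [← Set.iUnion_inter] at h1
    have h2 : (⋃ n : ℕ, {x | V x ≤ n}) = Set.univ := by
      ext x
      simpa using exists_nat_ge (V x)
    rw [h2, Set.univ_inter] at h1
    exact (measure_ball_pos volume (0 : Euc d) one_pos).ne' h1
  set A := {x | V x ≤ n} ∩ ball (0 : Euc d) 1 with hA
  have hAm : MeasurableSet A := (measurableSet_le hVm measurable_const).inter measurableSet_ball
  have hAt : volume A ≠ ⊤ :=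
    ne_top_of_le_ne_top measure_ball_lt_top.ne (measure_mono Set.inter_subset_right)
  set c := (volume A)⁻¹ with hc
  have hct : c ≠ ⊤ := ENNReal.inv_ne_top.2 hn
  set μ : Measure (Euc d) := c • volume.restrict A with hμ
  have hμp : IsProbabilityMeasure μ := by
    constructor
    simp only [hμ, Measure.smul_apply, Measure.restrict_apply_univ, smul_eq_mul, hc]
    exact ENNReal.inv_mul_cancel hn hAt
  refine ⟨μ, hμp, ?_⟩
  have hmemA : ∀ᵐ x ∂μ, x ∈ A := by
    rw [hμ]
    exact Measure.ae_smul_measure (ae_restrict_mem hAm) c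
  have hkm : Measurable fun x : Euc d => posP (coulombK d x) :=
    EReal.continuous_toENNReal.measurable.comp (coulombK_lsc d hd).measurable
  set M := ∫⁻ y in ball (0 : Euc d) 2, posP (coulombK d y) with hM
  have hbound : ∀ x ∈ A, ∫⁻ y, HC d V C (x, y) ∂μ ≤ c * M + ENNReal.ofReal (n + C) := by
    intro x hx
    have hpt : ∀ᵐ y ∂μ, HC d V C (x, y) ≤
        (ball (0 : Euc d) 2).indicator (fun y => posP (coulombK d y)) (x - y) +
          ENNReal.ofReal (n + C) := by
      filter_upwards [hmemA] with y hy
      have hxy : x - y ∈ ball (0 : Euc d) 2 := by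
        have h1 : ‖x‖ < 1 := by simpa using hx.2
        have h2 : ‖y‖ < 1 := by simpa using hy.2
        have := norm_sub_le x y
        rw [mem_ball_zero_iff]
        linarith
      rw [Set.indicator_of_mem hxy]
      unfold HC FF
      rw [add_assoc]
      refine (posP_add_le _ _).trans ?_
      gcongr
      rw [← EReal.coe_add, posP_coe]
      apply ENNReal.ofReal_le_ofReal
      have h1 : V x ≤ n := hx.1
      have h2 : V y ≤ n := hy.1
      simp only
      linarith
    refine (lintegral_mono_ae hpt).trans ?_
    rw [lintegral_add_right _ measurable_const, lintegral_const, measure_univ, mul_one]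
    gcongr
    rw [hμ, lintegral_smul_measure, smul_eq_mul]
    gcongr
    refine (setLIntegral_le_lintegral _ _).trans ?_
    rw [lintegral_sub_left_eq_self
      (fun y => (ball (0 : Euc d) 2).indicator (fun y => posP (coulombK d y)) y) x,
      lintegral_indicator measurableSet_ball]
  have hMt : M ≠ ⊤ := kball_finite d hd
  rw [lintegral_prod _ (HC_lsc d hd V hV C).measurable.aemeasurable]
  refine ne_top_of_le_ne_top (b := c * M + ENNReal.ofReal (n + C)) ?_ ?_
  · exact ENNReal.add_ne_top.2 ⟨ENNReal.mul_ne_top hct hMt, ENNReal.ofReal_ne_top⟩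
  · calc _ ≤ ∫⁻ _, (c * M + ENNReal.ofReal (n + C)) ∂μ := by
          apply lintegral_mono_ae
          filter_upwards [hmemA] with x hx using hbound x hx
      _ = _ := by simp

end finite

section uniq

lemma HC_symm (d : ℕ) (V : Euc d → ℝ) (C : ℝ) (z : Euc d × Euc d) :
    HC d V C z.swap = HC d V C z := by
  unfold HC FF
  have h : coulombK d (z.2 - z.1) = coulombK d (z.1 - z.2) := by
    unfold coulombK
    rw [norm_sub_rev]
    have : (z.2 - z.1 = 0) ↔ (z.1 - z.2 = 0) := by
      rw [sub_eq_zero, sub_eq_zero, eq_comm]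
    simp only [this]
  simp only [Prod.fst_swap, Prod.snd_swap, h, add_comm (V z.2)]

lemma HC_rep (d : ℕ) (hd : 2 ≤ d) (V : Euc d → ℝ) (C : ℝ) {T : ℝ} (hT : 0 < T)
    (hpos : ∀ x, 0 ≤ V x + C + gRad d T) (z : Euc d × Euc d) (hz : ‖z.1 - z.2‖ ≤ T) :
    HC d V C z = mixG (wK d) T ‖z.1 - z.2‖ + (ENNReal.ofReal ((V z.1 + C + gRad d T) / 2) +
      ENNReal.ofReal ((V z.2 + C + gRad d T) / 2)) := by
  have h1 := hpos z.1
  have h2 := hpos z.2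
  unfold HC FF
  rw [coulombK_rep d hd hT hz, ← ENNReal.ofReal_add (by linarith) (by linarith)]
  have : ((gRad d T : ℝ) : EReal) + ((mixG (wK d) T ‖z.1 - z.2‖ : ℝ≥0∞) : EReal) +
      (((V z.1 + V z.2) / 2 : ℝ) : EReal) + (C : EReal) =
      ((mixG (wK d) T ‖z.1 - z.2‖ : ℝ≥0∞) : EReal) +
      (((V z.1 + C + gRad d T) / 2 + (V z.2 + C + gRad d T) / 2 : ℝ) : EReal) := by
    rw [add_comm ((gRad d T : ℝ) : EReal), add_assoc, add_assoc, ← EReal.coe_add, ← EReal.coe_add]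
    congr 2
    ring
  rw [this, posP_eq, EReal.toENNReal_add (EReal.coe_ennreal_nonneg _)
    (EReal.coe_nonneg.2 (by linarith)), EReal.toENNReal_coe, ← posP_eq, posP_coe]

lemma mid_integral {X : Type*} [MeasurableSpace X] (H : X × X → ℝ≥0∞) (hH : Measurable H)
    (μ ν : Measure X) [IsProbabilityMeasure μ] [IsProbabilityMeasure ν] :
    ∫⁻ z, H z ∂(((2:ℝ≥0∞)⁻¹ • (μ + ν)).prod ((2:ℝ≥0∞)⁻¹ • (μ + ν))) =
      2⁻¹ * (2⁻¹ * ((∫⁻ z, H z ∂(μ.prod μ) + ∫⁻ z, H z ∂(μ.prod ν)) +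
        (∫⁻ z, H z ∂(ν.prod μ) + ∫⁻ z, H z ∂(ν.prod ν)))) := by
  have hfin : IsFiniteMeasure ((2:ℝ≥0∞)⁻¹ • (μ + ν)) := by
    constructor
    simp
  have hm : ∀ κ : Measure X, [SFinite κ] → Measurable fun x => ∫⁻ y, H (x, y) ∂κ :=
    fun κ _ => hH.lintegral_prod_right'
  rw [lintegral_prod _ hH.aemeasurable, lintegral_prod _ hH.aemeasurable,
    lintegral_prod _ hH.aemeasurable, lintegral_prod _ hH.aemeasurable,
    lintegral_prod _ hH.aemeasurable]
  simp only [lintegral_smul_measure, lintegral_add_measure, smul_eq_mul]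
  have hmm : Measurable fun x => ∫⁻ y, H (x, y) ∂μ + ∫⁻ y, H (x, y) ∂ν := (hm μ).add (hm ν)
  rw [lintegral_const_mul _ hmm, lintegral_const_mul _ hmm,
    lintegral_add_left (hm μ), lintegral_add_left (hm μ), ← mul_add]

lemma uniq_core (d : ℕ) (hd : 2 ≤ d) (V : Euc d → ℝ) (hV : LowerSemicontinuous V) (C : ℝ) {T : ℝ}
    (hT : 0 < T) (hpos : ∀ x, 0 ≤ V x + C + gRad d T) {K : Set (Euc d)}
    (hKT : ∀ x ∈ K, ∀ y ∈ K, ‖x - y‖ ≤ T)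
    (μ ν : Measure (Euc d)) [IsProbabilityMeasure μ] [IsProbabilityMeasure ν]
    (hμ : μ Kᶜ = 0) (hν : ν Kᶜ = 0)
    (hfin : ∫⁻ z, HC d V C z ∂(μ.prod μ) ≠ ⊤)
    (heq : ∫⁻ z, HC d V C z ∂(ν.prod ν) = ∫⁻ z, HC d V C z ∂(μ.prod μ))
    (hmin : ∀ κ : Measure (Euc d), IsProbabilityMeasure κ →
      ∫⁻ z, HC d V C z ∂(μ.prod μ) ≤ ∫⁻ z, HC d V C z ∂(κ.prod κ)) : μ = ν := by
  have hHm : Measurable (HC d V C) := (HC_lsc d hd V hV C).measurable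
  set f : Euc d → ℝ≥0∞ := fun x => ENNReal.ofReal ((V x + C + gRad d T) / 2) with hf
  have hfm : Measurable f := by
    have := hV.measurable
    rw [hf]; fun_prop
  have hsplit : ∀ (α β : Measure (Euc d)), IsProbabilityMeasure α → IsProbabilityMeasure β →
      α Kᶜ = 0 → β Kᶜ = 0 → ∫⁻ z, HC d V C z ∂(α.prod β) =
      ∫⁻ z : Euc d × Euc d, mixG (wK d) T ‖z.1 - z.2‖ ∂(α.prod β) +
        (∫⁻ x, f x ∂α + ∫⁻ x, f x ∂β) := by
    intro α β _ _ hα hβ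
    have h1 : ∫⁻ z, HC d V C z ∂(α.prod β) =
        ∫⁻ z, (mixG (wK d) T ‖z.1 - z.2‖ + (f z.1 + f z.2)) ∂(α.prod β) := by
      apply lintegral_congr_ae
      filter_upwards [ae_dist_le hKT α β hα hβ] with z hz
      exact HC_rep d hd V C hT hpos z hz
    have hf1 : Measurable fun z : Euc d × Euc d => f z.1 := hfm.comp measurable_fst
    have hf2 : Measurable fun z : Euc d × Euc d => f z.2 := hfm.comp measurable_snd
    have hf12 : Measurable fun z : Euc d × Euc d => f z.1 + f z.2 := hf1.add hf2
    rw [h1, lintegral_add_right _ hf12, lintegral_add_left hf1]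
    congr 2
    · rw [lintegral_prod _ hf1.aemeasurable]; simp
    · rw [lintegral_prod _ hf2.aemeasurable]; simp
  have hsym : ∫⁻ z, HC d V C z ∂(ν.prod μ) = ∫⁻ z, HC d V C z ∂(μ.prod ν) := by
    rw [← lintegral_prod_swap]
    exact lintegral_congr fun z => HC_symm d V C z
  have hm := hmin ((2:ℝ≥0∞)⁻¹ • (μ + ν)) (by
    constructor
    simp only [Measure.smul_apply, Measure.add_apply, measure_univ, smul_eq_mul]
    rw [one_add_one_eq_two]
    exact ENNReal.inv_mul_cancel (by simp) (by simp))
  rw [mid_integral _ hHm, hsym, heq] at hm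
  have hμμ := hsplit μ μ inferInstance inferInstance hμ hμ
  have hνν := hsplit ν ν inferInstance inferInstance hν hν
  have hμν := hsplit μ ν inferInstance inferInstance hμ hν
  have hmain : ∫⁻ z, HC d V C z ∂(μ.prod μ) + ∫⁻ z, HC d V C z ∂(ν.prod ν) ≤
      2 * ∫⁻ z, HC d V C z ∂(μ.prod ν) := by
    rw [heq]
    generalize ∫⁻ z, HC d V C z ∂(μ.prod μ) = N at *
    generalize ∫⁻ z, HC d V C z ∂(μ.prod ν) = M at *
    by_cases hM : M = ⊤
    · subst hM; simp
    lift N to ℝ≥0 using hfin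
    lift M to ℝ≥0 using hM
    have e : (2:ℝ≥0∞)⁻¹ = ((2⁻¹ : ℝ≥0) : ℝ≥0∞) := by simp
    rw [e] at hm
    norm_cast at hm ⊢
    rw [← NNReal.coe_le_coe] at hm ⊢
    push_cast at hm ⊢
    linarith
  rw [heq] at hνν
  have hfν : ∫⁻ x, f x ∂ν ≠ ⊤ := by
    intro h
    rw [h] at hνν
    simp at hνν
    exact hfin hνν
  have hfμ : ∫⁻ x, f x ∂μ ≠ ⊤ := by
    intro h
    rw [h] at hμμ
    simp at hμμ
    exact hfin hμμ
  have hIμ : ∫⁻ z : Euc d × Euc d, mixG (wK d) T ‖z.1 - z.2‖ ∂(μ.prod μ) ≠ ⊤ := by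
    intro h
    rw [h] at hμμ
    simp at hμμ
    exact hfin hμμ
  have hIν : ∫⁻ z : Euc d × Euc d, mixG (wK d) T ‖z.1 - z.2‖ ∂(ν.prod ν) ≠ ⊤ := by
    intro h
    rw [h] at hνν
    simp at hνν
    exact hfin hνν
  refine mix_convex (wK d) (wK_meas d) (wK_ne_zero d hd) (fun b _ => wK_ne_top d b) hKT μ ν hμ hν
    hIμ hIν ?_
  rw [heq] at hmain
  nth_rewrite 2 [hνν] at hmain
  rw [hμμ, hμν] at hmain
  generalize (∫⁻ z : Euc d × Euc d, mixG (wK d) T ‖z.1 - z.2‖ ∂(μ.prod μ)) = I1 at *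
  generalize (∫⁻ z : Euc d × Euc d, mixG (wK d) T ‖z.1 - z.2‖ ∂(ν.prod ν)) = I2 at *
  generalize (∫⁻ z : Euc d × Euc d, mixG (wK d) T ‖z.1 - z.2‖ ∂(μ.prod ν)) = I3 at *
  generalize (∫⁻ x, f x ∂μ) = f1 at *
  generalize (∫⁻ x, f x ∂ν) = f2 at *
  by_cases h3 : I3 = ⊤
  · subst h3; simp
  lift I1 to ℝ≥0 using hIμ
  lift I2 to ℝ≥0 using hIν
  lift I3 to ℝ≥0 using h3
  lift f1 to ℝ≥0 using hfμ
  lift f2 to ℝ≥0 using hfν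
  norm_cast at hmain ⊢
  rw [← NNReal.coe_le_coe] at hmain ⊢
  push_cast at hmain ⊢
  linarith

lemma energy_le_iff (d : ℕ) (hd : 2 ≤ d) (V : Euc d → ℝ) (hV : LowerSemicontinuous V) (C : ℝ)
    (hC : 0 ≤ C) (hb : ∀ z, ((-C : ℝ) : EReal) ≤ FF d V z) (μ ν : Measure (Euc d))
    [IsProbabilityMeasure μ] [IsProbabilityMeasure ν] :
    energy d V μ ≤ energy d V ν ↔
      ∫⁻ z, HC d V C z ∂(μ.prod μ) ≤ ∫⁻ z, HC d V C z ∂(ν.prod ν) := by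
  rw [energy_eq d hd V hV C hC hb μ, energy_eq d hd V hV C hC hb ν,
    ← EReal.coe_ennreal_le_coe_ennreal_iff]
  constructor
  · intro h
    have := add_le_add_left h (C : EReal)
    simpa only [EReal.sub_add_cancel] using this
  · intro h
    exact EReal.sub_le_sub h le_rfl

end uniq
/-- under the growth condition, the electrostatic energy has a unique
minimizer over `P(ℝ^d)`; it has compact support, its energy is `> -∞`, and the infima
over `P(ℝ^d)`, `P_p(ℝ^d)` and the compactly supported probability measures coincide
with the minimal value. -/
theorem stmt6 (d : ℕ) (hd : 2 ≤ d) (V : Euc d → ℝ) (hVlsc : LowerSemicontinuous V)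
    (a q R : ℝ) (ha : 0 < a) (hq : 1 < q) (hgrowth : GrowthCond d V a q R)
    (p : ℝ) (hp1 : 1 < p) (hpq : p < q) :
    ∃ μs : Measure (Euc d), IsProbabilityMeasure μs ∧
      (∃ K : Set (Euc d), IsCompact K ∧ μs Kᶜ = 0) ∧
      (∀ μ : Measure (Euc d), IsProbabilityMeasure μ → energy d V μs ≤ energy d V μ) ∧
      (∀ μ : Measure (Euc d), IsProbabilityMeasure μ →
        energy d V μ = energy d V μs → μ = μs) ∧
      (⊥ : EReal) < energy d V μs ∧
      (⨅ μ ∈ {μ : Measure (Euc d) | IsProbabilityMeasure μ}, energy d V μ) = energy d V μs ∧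
      (⨅ μ ∈ Ppd d p, energy d V μ) = energy d V μs ∧
      (⨅ μ ∈ {μ : Measure (Euc d) |
          IsProbabilityMeasure μ ∧ ∃ K : Set (Euc d), IsCompact K ∧ μ Kᶜ = 0},
        energy d V μ) = energy d V μs := by
  obtain ⟨C0, hC0, hb0⟩ := FF_bdd d hd V a q R ha hq hgrowth
  obtain ⟨μ0, hμ0, hfin0⟩ := exists_finite d hd V hVlsc C0
  have hlsc := HC_lsc d hd V hVlsc C0
  have hcoer := HC_coer d hd V a q R ha hq hgrowth C0
  obtain ⟨μs, hμs, hfins, hmins⟩ := exists_min (HC d V C0) hlsc hcoer μ0 hfin0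
  obtain ⟨K, hK, hKs⟩ := min_compact (HC d V C0) hlsc hcoer μs hfins hmins
  have hmin : ∀ μ : Measure (Euc d), IsProbabilityMeasure μ → energy d V μs ≤ energy d V μ := by
    intro μ hμ
    exact (energy_le_iff d hd V hVlsc C0 hC0 hb0 μs μ).2 (hmins μ hμ)
  have hmom : FiniteMoment d p μs := by
    obtain ⟨ρ, hρ⟩ := hK.isBounded.subset_closedBall (0 : Euc d)
    unfold FiniteMoment
    refine ne_top_of_le_ne_top (b := ENNReal.ofReal (ρ ^ p)) ENNReal.ofReal_ne_top ?_
    calc _ ≤ ∫⁻ _, ENNReal.ofReal (ρ ^ p) ∂μs := by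
          apply lintegral_mono_ae
          have : ∀ᵐ x ∂μs, x ∈ K := by rw [ae_iff]; exact hKs
          filter_upwards [this] with x hx
          apply ENNReal.ofReal_le_ofReal
          have h1 : ‖x‖ ≤ ρ := by simpa using hρ hx
          gcongr
      _ = _ := by simp
  refine ⟨μs, hμs, ⟨K, hK, hKs⟩, hmin, ?_, ?_, ?_, ?_, ?_⟩
  · intro μ hμ he
    have hle0 := (energy_le_iff d hd V hVlsc C0 hC0 hb0 μ μs).1 he.le
    obtain ⟨K', hK', hKs'⟩ := min_compact (HC d V C0) hlsc hcoer μ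
      (ne_top_of_le_ne_top hfins hle0) (fun κ hκ => hle0.trans (hmins κ hκ))
    obtain ⟨ρ, hρ⟩ := (hK.union hK').isBounded.subset_closedBall (0 : Euc d)
    have hKT : ∀ x ∈ K ∪ K', ∀ y ∈ K ∪ K', ‖x - y‖ ≤ 2 * |ρ| + 1 := by
      intro x hx y hy
      have h1 : ‖x‖ ≤ ρ := by simpa using hρ hx
      have h2 : ‖y‖ ≤ ρ := by simpa using hρ hy
      have h3 := norm_sub_le x y
      have h4 := le_abs_self ρ
      linarith
    have hT : 0 < 2 * |ρ| + 1 := by positivity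
    set T := 2 * |ρ| + 1 with hTdef
    set C := max C0 (R - gRad d T) with hCdef
    have hC : 0 ≤ C := hC0.trans (le_max_left _ _)
    have hb : ∀ z, ((-C : ℝ) : EReal) ≤ FF d V z := by
      intro z
      refine le_trans ?_ (hb0 z)
      rw [EReal.coe_le_coe_iff]
      have := le_max_left C0 (R - gRad d T)
      linarith
    have hpos : ∀ x, 0 ≤ V x + C + gRad d T := by
      intro x
      have h1 := hgrowth x
      have h2 := le_max_right C0 (R - gRad d T)
      have h3 : 0 ≤ ‖x‖ ^ q := by positivity
      have h4 : 0 ≤ a * ‖x‖ ^ q := by positivity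
      linarith
    have hiff := fun (α β : Measure (Euc d)) (hα : IsProbabilityMeasure α)
      (hβ : IsProbabilityMeasure β) => energy_le_iff d hd V hVlsc C hC hb α β
    have hfinC : ∫⁻ z, HC d V C z ∂(μs.prod μs) ≠ ⊤ := by
      intro htop
      have h1 := energy_eq d hd V hVlsc C hC hb μs
      have h2 := energy_eq d hd V hVlsc C0 hC0 hb0 μs
      rw [htop, EReal.coe_ennreal_top, EReal.top_sub_coe] at h1
      rw [h1] at h2
      lift (∫⁻ z, HC d V C0 z ∂(μs.prod μs)) to ℝ≥0 using hfins with N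
      have h3 : (⊤ : EReal) = ((N : ℝ) : EReal) - (C0 : EReal) := h2
      rw [← EReal.coe_sub] at h3
      exact EReal.coe_ne_top _ h3.symm
    refine (uniq_core d hd V hVlsc C hT hpos hKT μs μ ?_ ?_ hfinC ?_ ?_).symm
    · exact measure_mono_null (Set.compl_subset_compl.2 Set.subset_union_left) hKs
    · exact measure_mono_null (Set.compl_subset_compl.2 Set.subset_union_right) hKs'
    · exact le_antisymm ((hiff μ μs hμ hμs).1 he.le) ((hiff μs μ hμs hμ).1 he.ge)
    · intro κ hκ
      exact (hiff μs κ hμs hκ).1 (hmin κ hκ)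
  · rw [energy_eq d hd V hVlsc C0 hC0 hb0 μs]
    lift (∫⁻ z, HC d V C0 z ∂(μs.prod μs)) to ℝ≥0 using hfins with N
    change ⊥ < ((N : ℝ) : EReal) - (C0 : EReal)
    rw [← EReal.coe_sub]
    exact EReal.bot_lt_coe _
  · exact le_antisymm (iInf₂_le μs hμs) (le_iInf₂ fun μ hμ => hmin μ hμ)
  · exact le_antisymm (iInf₂_le μs ⟨hμs, hmom⟩) (le_iInf₂ fun μ hμ => hmin μ hμ.1)
  · exact le_antisymm (iInf₂_le μs ⟨hμs, K, hK, hKs⟩) (le_iInf₂ fun μ hμ => hmin μ hμ.1)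

end
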